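/- arXiv:1602.06435 — 5 statements merged into one kernel-verified Lean document; each statement's English description precedes it below -/
import Mathlib

section
/- If A is a dense subset of a uniform space X and A, with the subspace uniformity, is chain-connected, then X is chain-connected. -/
/-- A uniform space `X` is chain-connected if for every entourage `U` and all points
`x, y` there is a finite sequence `x = x₀, x₁, …, xₙ = y` with `(xᵢ, xᵢ₊₁) ∈ U`. -/
def IsChainConnected (X : Type*) [UniformSpace X] : Prop :=
  ∀ U ∈ uniformity X, ∀ x y : X, ∃ (n : ℕ) (c : Fin (n + 1) → X),
    c 0 = x ∧ c (Fin.last n) = y ∧ ∀ i : Fin n, (c i.castSucc, c i.succ) ∈ U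

/-- Finite chains for a relation witness exactly its reflexive transitive closure. -/
theorem exists_fin_chain_iff_reflTransGen {α : Type*} {r : α → α → Prop} {x y : α} :
    (∃ (n : ℕ) (c : Fin (n + 1) → α),
      c 0 = x ∧ c (Fin.last n) = y ∧ ∀ i : Fin n, r (c i.castSucc) (c i.succ)) ↔
    Relation.ReflTransGen r x y := by
  constructor
  · rintro ⟨n, c, rfl, rfl, hc⟩
    have key : ∀ i, Relation.ReflTransGen r (c 0) (c i) := fun i =>
      Fin.induction .refl (fun j hj => hj.tail (hc j)) i
    exact key _
  · intro h
    induction h with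
    | refl => exact ⟨0, fun _ => x, rfl, rfl, fun i => i.elim0⟩
    | @tail b z _ hbz ih =>
      obtain ⟨n, c, h0, hl, hc⟩ := ih
      refine ⟨n + 1, Fin.snoc (α := fun _ => α) c z, ?_, Fin.snoc_last _ _, fun i => ?_⟩
      · rw [← Fin.castSucc_zero, Fin.snoc_castSucc, h0]
      · refine Fin.lastCases ?_ (fun j => ?_) i
        · rw [Fin.snoc_castSucc, Fin.succ_last, Fin.snoc_last, hl]
          exact hbz
        · rw [Fin.snoc_castSucc, Fin.succ_castSucc, Fin.snoc_castSucc]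
          exact hc j

/-- If a dense subset `A` of a uniform space `X` is chain-connected (with the subspace
uniformity), then `X` is chain-connected. -/
theorem chainConnected_of_dense_chainConnected (X : Type*) [UniformSpace X]
    (A : Set X) (hA : Dense A) (hcc : IsChainConnected A) : IsChainConnected X := by
  intro U hU x y
  obtain ⟨a, ha, hxa⟩ := hA.inter_nhds_nonempty (mem_nhds_left x hU)
  obtain ⟨b, hb, hby⟩ := hA.inter_nhds_nonempty (mem_nhds_right y hU)
  have hUA : {p : A × A | ((p.1 : X), (p.2 : X)) ∈ U} ∈ uniformity A :=
    uniformContinuous_subtype_val hU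
  have hab : Relation.ReflTransGen (fun u v : A => ((u : X), (v : X)) ∈ U) ⟨a, ha⟩ ⟨b, hb⟩ :=
    exists_fin_chain_iff_reflTransGen.mp (hcc _ hUA ⟨a, ha⟩ ⟨b, hb⟩)
  have hab' : Relation.ReflTransGen (fun u v : X => (u, v) ∈ U) a b :=
    Relation.ReflTransGen.lift (r := fun u v : A => ((u : X), (v : X)) ∈ U)
      (p := fun u v : X => (u, v) ∈ U) Subtype.val (fun _ _ h => h) ⟨a, ha⟩ ⟨b, hb⟩ hab
  exact exists_fin_chain_iff_reflTransGen.mpr ((hab'.head hxa).tail hby)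
end

section
/- Let S and T be types with reflexive symmetric relations r_S and r_T respectively, and let f, g : S → T be maps such that for all a, b ∈ S with r_S(a, b), all three of r_T(f(a), f(b)), r_T(g(a), g(b)), and r_T(f(a), g(b)) hold. Then the induced chain maps f_#, g_# : M_•(S, r_S) → M_•(T, r_T) (defined on generators by applying f, resp. g, to each vertex) are chain homotopic: the prism operators P_p : M_p(S, r_S) → M_{p+1}(T, r_T), defined on generators by P_p(a_0, …, a_p) = Σ_{j=0}^{p} (−1)^j (f(a_0), …, f(a_j), g(a_j), …, g(a_p)), are well-defined (each summand is an r_T-simplex) and satisfy ∂_{p+1} ∘ P_p + P_{p−1} ∘ ∂_p = g_# − f_# in every degree p. -/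
/-- An `r`-simplex: a tuple whose vertices are pairwise `r`-related. -/
def IsSimplex {S : Type*} (r : S → S → Prop) {n : ℕ} (σ : Fin n → S) : Prop :=
  ∀ i j, r (σ i) (σ j)

/-- The degree-`p` part of the Vietoris chain complex of `(S, r)`: the free abelian
group on the `p`-dimensional `r`-simplices. -/
abbrev MGroup (S : Type*) (r : S → S → Prop) (p : ℕ) : Type _ :=
  FreeAbelianGroup {σ : Fin (p + 1) → S // IsSimplex r σ}

/-- The boundary map `∂ : M_{p+1} → M_p`,
`∂(a₀, …, a_{p+1}) = Σᵢ (-1)ⁱ (a₀, …, âᵢ, …, a_{p+1})`. -/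
def boundary {S : Type*} (r : S → S → Prop) (p : ℕ) :
    MGroup S r (p + 1) →+ MGroup S r p :=
  FreeAbelianGroup.lift fun σ =>
    ∑ i : Fin (p + 2), ((-1 : ℤ) ^ (i : ℕ)) •
      FreeAbelianGroup.of
        (⟨σ.1 ∘ i.succAbove, fun _ _ => σ.2 _ _⟩ : {τ : Fin (p + 1) → S // IsSimplex r τ})

/-- The augmentation `ε : M₀ → ℤ` sending every `0`-simplex to `1`. -/
def augmentation (S : Type*) (r : S → S → Prop) : MGroup S r 0 →+ ℤ :=
  FreeAbelianGroup.lift fun _ => (1 : ℤ)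

/-- The chain map induced by a relation-preserving map of vertices. -/
def inducedMap {S T : Type*} {rS : S → S → Prop} {rT : T → T → Prop} (f : S → T)
    (hf : ∀ a b, rS a b → rT (f a) (f b)) (p : ℕ) :
    MGroup S rS p →+ MGroup T rT p :=
  FreeAbelianGroup.lift fun σ =>
    FreeAbelianGroup.of ⟨f ∘ σ.1, fun i j => hf _ _ (σ.2 i j)⟩

/-- The `j`-th prism tuple `(f a₀, …, f aⱼ, g aⱼ, …, g a_p)` associated to a tuple
`(a₀, …, a_p)` and vertex maps `f, g`. -/
def prismTuple {S T : Type*} (f g : S → T) {p : ℕ} (σ : Fin (p + 1) → S)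
    (j : Fin (p + 1)) : Fin (p + 2) → T := fun i =>
  if h : (i : ℕ) ≤ (j : ℕ) then f (σ ⟨i, Nat.lt_of_le_of_lt h j.isLt⟩)
  else g (σ ⟨(i : ℕ) - 1, by have := i.isLt; omega⟩)

/-- The `j`-th prism tuple is an `rT`-simplex (well-definedness of the prism
operator). -/
def prismSimplex {S T : Type*} {rS : S → S → Prop} {rT : T → T → Prop} (f g : S → T)
    (hrT_symm : ∀ a b, rT a b → rT b a)
    (hf : ∀ a b, rS a b → rT (f a) (f b)) (hg : ∀ a b, rS a b → rT (g a) (g b))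
    (hfg : ∀ a b, rS a b → rT (f a) (g b)) {p : ℕ}
    (σ : {σ : Fin (p + 1) → S // IsSimplex rS σ}) (j : Fin (p + 1)) :
    {τ : Fin (p + 2) → T // IsSimplex rT τ} :=
  ⟨prismTuple f g σ.1 j, by
    intro i k
    unfold prismTuple
    by_cases hi : (i : ℕ) ≤ (j : ℕ) <;> by_cases hk : (k : ℕ) ≤ (j : ℕ) <;>
      simp only [hi, hk, dite_true, dite_false, dif_pos, dif_neg, not_false_iff]
    · exact hf _ _ (σ.2 _ _)
    · exact hfg _ _ (σ.2 _ _)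
    · exact hrT_symm _ _ (hfg _ _ (σ.2 _ _))
    · exact hg _ _ (σ.2 _ _)⟩

section PrismFaces

variable {S T : Type*}

/-- The tuple obtained from `σ` by applying `f` to the first `n` vertices and `g` to the
remaining ones. -/
def mixedTuple (f g : S → T) {p : ℕ} (σ : Fin p → S) (n : ℕ) : Fin p → T := fun i =>
  if (i : ℕ) < n then f (σ i) else g (σ i)

lemma prismTuple_comp_succAbove_castSucc (f g : S → T) {p : ℕ} (σ : Fin (p + 1) → S)
    (j : Fin (p + 1)) :
    prismTuple f g σ j ∘ j.castSucc.succAbove = mixedTuple f g σ j := by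
  ext k
  simp only [Function.comp_apply, prismTuple, mixedTuple, Fin.succAbove, Fin.lt_def,
    Fin.val_castSucc]
  by_cases h : (k : ℕ) < j
  · simp [h, h.le]
  · simp [h, show ¬ (k : ℕ) + 1 ≤ j by omega]

lemma prismTuple_comp_succAbove_succ (f g : S → T) {p : ℕ} (σ : Fin (p + 1) → S)
    (j : Fin (p + 1)) :
    prismTuple f g σ j ∘ j.succ.succAbove = mixedTuple f g σ (j + 1) := by
  ext k
  simp only [Function.comp_apply, prismTuple, mixedTuple, Fin.succAbove, Fin.lt_def,
    Fin.val_castSucc, Fin.val_succ]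
  by_cases h : (k : ℕ) < j + 1
  · simp [h, Nat.lt_succ_iff.mp h]
  · simp [h, show ¬ (k : ℕ) + 1 ≤ j by omega]

lemma Fin.val_succAbove_eq_ite {n : ℕ} (i : Fin (n + 1)) (k : Fin n) :
    (i.succAbove k : ℕ) = if (k : ℕ) < i then (k : ℕ) else k + 1 := by
  simp only [Fin.succAbove, Fin.lt_def, Fin.val_castSucc]
  split_ifs <;> simp

lemma Fin.val_predAbove_eq_ite {n : ℕ} (m : Fin n) (j : Fin (n + 1)) :
    (m.predAbove j : ℕ) = if (m : ℕ) < j then (j : ℕ) - 1 else j := by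
  simp only [Fin.predAbove, Fin.lt_def, Fin.val_castSucc]
  split_ifs <;> simp

lemma prismTuple_comp_succAbove_succAbove (f g : S → T) {p : ℕ} (σ : Fin (p + 2) → S)
    (j : Fin (p + 2)) (m : Fin (p + 1)) :
    prismTuple f g σ j ∘ (j.castSucc.succAbove (j.succAbove m)).succAbove =
      prismTuple f g (σ ∘ (j.succAbove m).succAbove) (m.predAbove j) := by
  ext k
  simp only [Function.comp_apply, prismTuple, Fin.val_succAbove_eq_ite,
    Fin.val_predAbove_eq_ite, Fin.val_castSucc]
  split_ifs <;> first
    | omega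
    | try rw [dif_pos (by omega)]
      refine congrArg f (congrArg σ (Fin.ext ?_))
      simp only [Fin.val_succAbove_eq_ite]
      split_ifs <;> omega
    | try rw [dif_neg (by omega)]
      refine congrArg g (congrArg σ (Fin.ext ?_))
      simp only [Fin.val_succAbove_eq_ite]
      split_ifs <;> omega

end PrismFaces

section AlternatingSums

variable {A : Type*} [AddCommGroup A]

/-- Reindexing by `(j, m) ↦ (m.predAbove j, j.succAbove m)` reverses the sign of an
alternating double sum. -/
lemma Fin.sum_neg_one_pow_smul_predAbove_succAbove {p : ℕ} (e : Fin (p + 1) → Fin (p + 2) → A) :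
    ∑ j : Fin (p + 2), ∑ m : Fin (p + 1),
        ((-1 : ℤ) ^ ((j : ℕ) + m)) • e (m.predAbove j) (j.succAbove m) =
      -∑ i : Fin (p + 2), ∑ j : Fin (p + 1), ((-1 : ℤ) ^ ((i : ℕ) + j)) • e j i := by
  simp only [← Fintype.sum_prod_type', ← Finset.sum_neg_distrib]
  refine Finset.sum_nbij' (fun x => (x.1.succAbove x.2, x.2.predAbove x.1))
    (fun x => (x.1.succAbove x.2, x.2.predAbove x.1)) (by simp) (by simp) ?_ ?_ ?_
  · rintro ⟨j, m⟩ -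
    simp [Fin.succAbove_succAbove_predAbove, Fin.predAbove_predAbove_succAbove]
  · rintro ⟨j, m⟩ -
    simp [Fin.succAbove_succAbove_predAbove, Fin.predAbove_predAbove_succAbove]
  · rintro ⟨j, m⟩ -
    rw [← neg_smul]
    congr 1
    rcases lt_or_ge m.castSucc j with h | h
    · obtain ⟨j, rfl⟩ := Fin.exists_succ_eq.mpr (Fin.ne_zero_of_lt h)
      rw [Fin.succAbove_of_castSucc_lt _ _ h, Fin.predAbove_of_castSucc_lt _ _ h]
      simp
      ring
    · rw [Fin.succAbove_of_le_castSucc _ _ h, Fin.predAbove_of_le_castSucc _ _ h]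
      simp
      ring

lemma Fin.sum_sub_telescope (u : ℕ → A) (n : ℕ) :
    ∑ j : Fin n, (u j - u (j + 1)) = u 0 - u n := by
  rw [Fin.sum_univ_eq_sum_range (fun j => u j - u (j + 1)), Finset.sum_range_sub']

/-- Splitting off the two inner faces `j` and `j + 1` from an alternating sum. -/
lemma Fin.neg_one_pow_smul_sum {p : ℕ} (j : Fin (p + 2)) (d : Fin (p + 3) → A) :
    ((-1 : ℤ) ^ (j : ℕ)) • ∑ i : Fin (p + 3), ((-1 : ℤ) ^ (i : ℕ)) • d i =
      d j.castSucc - d j.succ + ∑ m : Fin (p + 1),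
        ((-1 : ℤ) ^ ((j : ℕ) + m)) • d (j.castSucc.succAbove (j.succAbove m)) := by
  rw [Fin.sum_univ_succAbove _ j.castSucc, Fin.sum_univ_succAbove _ j, smul_add, smul_add,
    ← add_assoc, Fin.succAbove_castSucc_self, smul_smul, smul_smul, Finset.smul_sum]
  congr 1
  · rw [Fin.val_castSucc, Fin.val_succ, pow_succ, ← mul_assoc, ← mul_pow]
    simp [sub_eq_add_neg]
  · refine Finset.sum_congr rfl fun m _ => ?_
    rw [smul_smul, ← pow_add]
    congr 1
    rcases lt_or_ge m.castSucc j with h | h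
    · rw [Fin.succAbove_of_castSucc_lt _ _ h,
        Fin.succAbove_of_castSucc_lt _ _ (show m.castSucc.castSucc < j.castSucc from h)]
      simp
    · rw [Fin.succAbove_of_le_castSucc _ _ h, Fin.succAbove_of_le_castSucc _ _
        (show j.castSucc ≤ m.succ.castSucc from h.trans (Fin.castSucc_lt_succ).le)]
      simp only [Fin.val_succ, ← add_assoc]
      rw [pow_add _ _ 1, pow_add _ _ 1]
      simp

end AlternatingSums

/-- The prism operator `(a₀, …, a_p) ↦ Σⱼ (-1)ʲ (f a₀, …, f aⱼ, g aⱼ, …, g a_p)`. -/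
def prismOperator {S T : Type*} {rS : S → S → Prop} {rT : T → T → Prop} (f g : S → T)
    (hrT_symm : ∀ a b, rT a b → rT b a)
    (hf : ∀ a b, rS a b → rT (f a) (f b)) (hg : ∀ a b, rS a b → rT (g a) (g b))
    (hfg : ∀ a b, rS a b → rT (f a) (g b)) (p : ℕ) :
    MGroup S rS p →+ MGroup T rT (p + 1) :=
  FreeAbelianGroup.lift fun σ => ∑ j : Fin (p + 1), ((-1 : ℤ) ^ (j : ℕ)) •
    FreeAbelianGroup.of (prismSimplex f g hrT_symm hf hg hfg σ j)

/-- The simplex obtained from `σ` by applying `f` to the first `n` vertices and `g` to the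
remaining ones. -/
def mixedSimplex {S T : Type*} {rS : S → S → Prop} {rT : T → T → Prop} (f g : S → T)
    (hrT_symm : ∀ a b, rT a b → rT b a)
    (hf : ∀ a b, rS a b → rT (f a) (f b)) (hg : ∀ a b, rS a b → rT (g a) (g b))
    (hfg : ∀ a b, rS a b → rT (f a) (g b)) {p : ℕ}
    (σ : {σ : Fin (p + 1) → S // IsSimplex rS σ}) (n : ℕ) :
    {τ : Fin (p + 1) → T // IsSimplex rT τ} :=
  ⟨mixedTuple f g σ.1 n, fun i k => by
    unfold mixedTuple
    split_ifs
    · exact hf _ _ (σ.2 _ _)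
    · exact hfg _ _ (σ.2 _ _)
    · exact hrT_symm _ _ (hfg _ _ (σ.2 _ _))
    · exact hg _ _ (σ.2 _ _)⟩

section ChainHomotopy

variable {S T : Type*} {rS : S → S → Prop} {rT : T → T → Prop} (f g : S → T)
  (hrT_symm : ∀ a b, rT a b → rT b a)
  (hf : ∀ a b, rS a b → rT (f a) (f b)) (hg : ∀ a b, rS a b → rT (g a) (g b))
  (hfg : ∀ a b, rS a b → rT (f a) (g b))

lemma inducedMap_sub_inducedMap_of {p : ℕ} (σ : {σ : Fin (p + 1) → S // IsSimplex rS σ}) :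
    (inducedMap g hg p - inducedMap f hf p) (FreeAbelianGroup.of σ) =
      FreeAbelianGroup.of (mixedSimplex f g hrT_symm hf hg hfg σ 0) -
        FreeAbelianGroup.of (mixedSimplex f g hrT_symm hf hg hfg σ (p + 1)) := by
  simp only [AddMonoidHom.sub_apply, inducedMap, FreeAbelianGroup.lift_apply_of]
  refine congrArg₂ (FreeAbelianGroup.of · - FreeAbelianGroup.of ·)
    (Subtype.ext (funext fun i => ?_)) (Subtype.ext (funext fun i => ?_))
  · simp [mixedSimplex, mixedTuple]
  · exact (if_pos i.isLt).symm

/-- The signed boundary of the `j`-th prism simplex: its two inner faces, and its outer faces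
written as prism simplices over the faces of `σ`. -/
lemma neg_one_pow_smul_boundary_prismSimplex {p : ℕ}
    (σ : {σ : Fin (p + 2) → S // IsSimplex rS σ}) (j : Fin (p + 2)) :
    ((-1 : ℤ) ^ (j : ℕ)) • boundary rT (p + 1)
        (FreeAbelianGroup.of (prismSimplex f g hrT_symm hf hg hfg σ j)) =
      FreeAbelianGroup.of (mixedSimplex f g hrT_symm hf hg hfg σ j) -
          FreeAbelianGroup.of (mixedSimplex f g hrT_symm hf hg hfg σ (j + 1)) +
        ∑ m : Fin (p + 1), ((-1 : ℤ) ^ ((j : ℕ) + m)) •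
          FreeAbelianGroup.of (prismSimplex f g hrT_symm hf hg hfg
            ⟨σ.1 ∘ (j.succAbove m).succAbove, fun _ _ => σ.2 _ _⟩ (m.predAbove j)) := by
  rw [boundary, FreeAbelianGroup.lift_apply_of]
  refine (Fin.neg_one_pow_smul_sum j _).trans (congrArg₂ (· + ·) ?_ ?_)
  · exact congrArg₂ (FreeAbelianGroup.of · - FreeAbelianGroup.of ·)
      (Subtype.ext (prismTuple_comp_succAbove_castSucc f g σ.1 j))
      (Subtype.ext (prismTuple_comp_succAbove_succ f g σ.1 j))
  · exact Finset.sum_congr rfl fun m _ => congrArg (_ • FreeAbelianGroup.of ·)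
      (Subtype.ext (prismTuple_comp_succAbove_succAbove f g σ.1 j m))

lemma prismOperator_of {p : ℕ} (σ : {σ : Fin (p + 1) → S // IsSimplex rS σ}) :
    prismOperator f g hrT_symm hf hg hfg p (FreeAbelianGroup.of σ) =
      ∑ j : Fin (p + 1), ((-1 : ℤ) ^ (j : ℕ)) •
        FreeAbelianGroup.of (prismSimplex f g hrT_symm hf hg hfg σ j) :=
  FreeAbelianGroup.lift_apply_of _ _

lemma boundary_prismOperator_zero :
    (boundary rT 0).comp (prismOperator f g hrT_symm hf hg hfg 0) =
      inducedMap g hg 0 - inducedMap f hf 0 := by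
  ext σ
  rw [inducedMap_sub_inducedMap_of f g hrT_symm hf hg hfg, AddMonoidHom.comp_apply,
    prismOperator_of, Fin.sum_univ_one, Fin.val_zero, pow_zero, one_smul, boundary,
    FreeAbelianGroup.lift_apply_of, Fin.sum_univ_two, Fin.val_zero, Fin.val_one, pow_zero,
    pow_one, one_smul, neg_one_smul, ← sub_eq_add_neg]
  exact congrArg₂ (FreeAbelianGroup.of · - FreeAbelianGroup.of ·)
    (Subtype.ext (prismTuple_comp_succAbove_castSucc f g σ.1 0))
    (Subtype.ext (prismTuple_comp_succAbove_succ f g σ.1 0))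

lemma boundary_prismOperator_succ (p : ℕ) :
    (boundary rT (p + 1)).comp (prismOperator f g hrT_symm hf hg hfg (p + 1)) +
        (prismOperator f g hrT_symm hf hg hfg p).comp (boundary rS p) =
      inducedMap g hg (p + 1) - inducedMap f hf (p + 1) := by
  ext σ
  rw [inducedMap_sub_inducedMap_of f g hrT_symm hf hg hfg, AddMonoidHom.add_apply,
    AddMonoidHom.comp_apply, AddMonoidHom.comp_apply, prismOperator_of, boundary.eq_1 rS,
    FreeAbelianGroup.lift_apply_of]
  simp only [map_sum, map_zsmul, neg_one_pow_smul_boundary_prismSimplex, prismOperator_of,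
    Finset.smul_sum, smul_smul, ← pow_add, Finset.sum_add_distrib]
  rw [Fin.sum_neg_one_pow_smul_predAbove_succAbove fun j i => FreeAbelianGroup.of
      (prismSimplex f g hrT_symm hf hg hfg ⟨σ.1 ∘ i.succAbove, fun _ _ => σ.2 _ _⟩ j),
    neg_add_cancel_right]
  exact Fin.sum_sub_telescope
    (fun n => FreeAbelianGroup.of (mixedSimplex f g hrT_symm hf hg hfg σ n)) _

end ChainHomotopy

/-- If `f, g : S → T` preserve the relations and moreover `rT (f a) (g b)` whenever
`rS a b`, then the induced chain maps `f₁, g₁ : M_•(S, rS) → M_•(T, rT)` are chain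
homotopic via the prism operators
`P_p (a₀, …, a_p) = Σⱼ (-1)ʲ (f a₀, …, f aⱼ, g aⱼ, …, g a_p)`:
each prism tuple is a simplex, and `∂ ∘ P + P ∘ ∂ = g₁ - f₁` in every degree. -/
theorem prism_chain_homotopy {S T : Type*} (rS : S → S → Prop) (rT : T → T → Prop)
    (hrS_refl : ∀ a, rS a a) (hrS_symm : ∀ a b, rS a b → rS b a)
    (hrT_refl : ∀ a, rT a a) (hrT_symm : ∀ a b, rT a b → rT b a)
    (f g : S → T)
    (hf : ∀ a b, rS a b → rT (f a) (f b)) (hg : ∀ a b, rS a b → rT (g a) (g b))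
    (hfg : ∀ a b, rS a b → rT (f a) (g b)) :
    (∀ (p : ℕ) (σ : {σ : Fin (p + 1) → S // IsSimplex rS σ}) (j : Fin (p + 1)),
        IsSimplex rT (prismTuple f g σ.1 j)) ∧
      ∃ P : ∀ p : ℕ, MGroup S rS p →+ MGroup T rT (p + 1),
        (∀ (p : ℕ) (σ : {σ : Fin (p + 1) → S // IsSimplex rS σ}),
            P p (FreeAbelianGroup.of σ) =
              ∑ j : Fin (p + 1), ((-1 : ℤ) ^ (j : ℕ)) •
                FreeAbelianGroup.of (prismSimplex f g hrT_symm hf hg hfg σ j)) ∧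
          ((boundary rT 0).comp (P 0) = inducedMap g hg 0 - inducedMap f hf 0) ∧
          ∀ p : ℕ, (boundary rT (p + 1)).comp (P (p + 1)) + (P p).comp (boundary rS p) =
            inducedMap g hg (p + 1) - inducedMap f hf (p + 1) := by
  exact ⟨fun p σ j => (prismSimplex f g hrT_symm hf hg hfg σ j).2,
    prismOperator f g hrT_symm hf hg hfg,
    fun _ σ => prismOperator_of f g hrT_symm hf hg hfg σ,
    boundary_prismOperator_zero f g hrT_symm hf hg hfg,
    boundary_prismOperator_succ f g hrT_symm hf hg hfg⟩
end

section
/- Let S be a type and r a reflexive symmetric relation on S. If the kernel of the augmentation ε : M_0(S, r) → ℤ is contained in the image of the boundary map ∂_1 : M_1(S, r) → M_0(S, r), then S is r-chain-connected. -/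
/-- Points joined by the reflexive transitive closure of `r` are joined by a finite `r`-chain. -/
theorem exists_chain_of_reflTransGen {S : Type*} {r : S → S → Prop} {x y : S}
    (hxy : Relation.ReflTransGen r x y) :
    ∃ (n : ℕ) (c : Fin (n + 1) → S),
      c 0 = x ∧ c (Fin.last n) = y ∧ ∀ i : Fin n, r (c i.castSucc) (c i.succ) := by
  induction hxy with
  | refl => exact ⟨0, fun _ => x, rfl, rfl, fun i => i.elim0⟩
  | @tail b z _ hbz ih =>
    obtain ⟨n, c, h0, hn, hc⟩ := ih
    refine ⟨n + 1, Fin.snoc (α := fun _ => S) c z, ?_, Fin.snoc_last _ _, fun i => ?_⟩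
    · rw [← Fin.castSucc_zero, Fin.snoc_castSucc, h0]
    · induction i using Fin.lastCases with
      | last => rw [Fin.snoc_castSucc, Fin.succ_last, Fin.snoc_last, hn]; exact hbz
      | cast i => rw [Fin.snoc_castSucc, Fin.succ_castSucc, Fin.snoc_castSucc]; exact hc i

/-- A homomorphism on `0`-chains induced by a function on vertices that is constant along `r`
vanishes on boundaries. -/
theorem lift_comp_boundary_eq_zero {S A : Type*} [AddCommGroup A] (r : S → S → Prop) (f : S → A)
    (hf : ∀ a b, r a b → f a = f b) :
    (FreeAbelianGroup.lift fun σ : {σ : Fin 1 → S // IsSimplex r σ} => f (σ.1 0)).comp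
      (boundary r 0) = 0 := by
  ext σ
  have h10 : f (σ.1 1) = f (σ.1 0) := hf _ _ (σ.2 1 0)
  simp [boundary, Fin.sum_univ_two, h10]

/-- If `ker ε ⊆ im ∂₁` in the Vietoris chain complex of `(S, r)`, then `S` is
`r`-chain-connected. -/
theorem chainConnected_of_ker_augmentation_le_range_boundary {S : Type*}
    (r : S → S → Prop) (hrefl : ∀ a, r a a) (hsymm : ∀ a b, r a b → r b a)
    (h : (augmentation S r).ker ≤ (boundary r 0).range) :
    ∀ x y : S, ∃ (n : ℕ) (c : Fin (n + 1) → S),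
      c 0 = x ∧ c (Fin.last n) = y ∧ ∀ i : Fin n, r (c i.castSucc) (c i.succ) := by
  classical
  intro x y
  apply exists_chain_of_reflTransGen
  let v (a : S) : MGroup S r 0 := FreeAbelianGroup.of ⟨fun _ => a, fun _ _ => hrefl a⟩
  let f (a : S) : ℤ := if Relation.ReflTransGen r x a then 1 else 0
  have hf (a b : S) (hab : r a b) : f a = f b := by
    have : Relation.ReflTransGen r x a ↔ Relation.ReflTransGen r x b :=
      ⟨fun ha => ha.tail hab, fun hb => hb.tail (hsymm a b hab)⟩
    simp only [f, this]
  have hker : v y - v x ∈ (augmentation S r).ker := by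
    simp [AddMonoidHom.mem_ker, v, augmentation]
  obtain ⟨m, hm⟩ := h hker
  have hzero := DFunLike.congr_fun (lift_comp_boundary_eq_zero r f hf) m
  rw [AddMonoidHom.comp_apply, hm] at hzero
  by_contra hxy
  simp [v, f, hxy, Relation.ReflTransGen.refl] at hzero
end

section
/- Let S be a type and r a reflexive symmetric relation on S, and let ~ denote the equivalence relation generated by r (x ~ y iff x and y are joined by a finite r-chain). If the quotient S/~ has exactly n elements, where n ≥ 1 is a natural number, then the zeroth homology H_0(M_•(S, r)) = M_0(S, r) / im ∂_1 is isomorphic to ℤ^n. -/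
/-- The chain-equivalence relation: `x ~ y` iff `x` and `y` are joined by a finite
`r`-chain. -/
def ChainRel {S : Type*} (r : S → S → Prop) (x y : S) : Prop :=
  ∃ (n : ℕ) (c : Fin (n + 1) → S),
    c 0 = x ∧ c (Fin.last n) = y ∧ ∀ i : Fin n, r (c i.castSucc) (c i.succ)

theorem range_boundary_le_ker_map_quotMk {S : Type*} (r : S → S → Prop) :
    (boundary r 0).range ≤
      (FreeAbelianGroup.map fun σ : {σ : Fin (0 + 1) → S // IsSimplex r σ} =>
        Quot.mk (ChainRel r) (σ.1 0)).ker := by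
  rw [AddMonoidHom.range_le_ker_iff]
  ext σ
  have h : Quot.mk (ChainRel r) (σ.1 0) = Quot.mk (ChainRel r) (σ.1 1) :=
    Quot.sound ⟨1, σ.1, rfl, rfl, fun i => σ.2 _ _⟩
  simp [boundary, Fin.sum_univ_two, h]

/-- The class in `H₀` of the `0`-simplex at a point. -/
def pointClass {S : Type*} (r : S → S → Prop) (hrefl : ∀ a, r a a) (x : S) :
    MGroup S r 0 ⧸ (boundary r 0).range :=
  QuotientAddGroup.mk (FreeAbelianGroup.of ⟨fun _ => x, fun _ _ => hrefl x⟩)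

theorem pointClass_eq_of_rel {S : Type*} (r : S → S → Prop) (hrefl : ∀ a, r a a)
    (hsymm : ∀ a b, r a b → r b a) {x y : S} (h : r x y) :
    pointClass r hrefl x = pointClass r hrefl y := by
  refine QuotientAddGroup.eq.2 ⟨FreeAbelianGroup.of ⟨![x, y], ?_⟩, ?_⟩
  · simp [IsSimplex, Fin.forall_fin_two, hrefl, h, hsymm x y h]
  · have h0 : ![x, y] ∘ (0 : Fin 2).succAbove = fun _ => y := by
      ext i; fin_cases i; rfl
    have h1 : ![x, y] ∘ (1 : Fin 2).succAbove = fun _ => x := by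
      ext i; fin_cases i; rfl
    simp only [boundary, FreeAbelianGroup.lift_apply_of, Nat.reduceAdd, Fin.sum_univ_two,
      Fin.val_zero, Fin.val_one, pow_zero, pow_one, one_smul, neg_smul, h0, h1]
    exact add_comm _ _

theorem pointClass_eq_of_chainRel {S : Type*} (r : S → S → Prop) (hrefl : ∀ a, r a a)
    (hsymm : ∀ a b, r a b → r b a) {x y : S} (h : ChainRel r x y) :
    pointClass r hrefl x = pointClass r hrefl y := by
  obtain ⟨n, c, rfl, rfl, hc⟩ := h
  suffices ∀ i, pointClass r hrefl (c 0) = pointClass r hrefl (c i) from this _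
  intro i
  induction i using Fin.induction with
  | zero => rfl
  | succ i ih => exact ih.trans (pointClass_eq_of_rel r hrefl hsymm (hc i))

/-- `H₀` is the free abelian group on the chain-equivalence classes. -/
def zerothHomologyEquiv {S : Type*} (r : S → S → Prop) (hrefl : ∀ a, r a a)
    (hsymm : ∀ a b, r a b → r b a) :
    (MGroup S r 0 ⧸ (boundary r 0).range) ≃+ FreeAbelianGroup (Quot (ChainRel r)) :=
  AddMonoidHom.toAddEquiv
    (QuotientAddGroup.lift _ _ (range_boundary_le_ker_map_quotMk r))
    (FreeAbelianGroup.lift (Quot.lift (pointClass r hrefl)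
      fun _ _ => pointClass_eq_of_chainRel r hrefl hsymm))
    (by
      ext σ
      have h : (fun _ => σ.1 0) = σ.1 := by
        ext i; fin_cases i; rfl
      simp [pointClass, h])
    (by
      ext q
      induction q using Quot.ind
      simp [pointClass])

/-- If the quotient of `S` by the chain-equivalence relation generated by `r` has
exactly `n ≥ 1` elements, then `H₀(M_•(S, r)) = M₀ / im ∂₁` is isomorphic to `ℤⁿ`. -/
theorem zerothHomology_iso_int_pow {S : Type*} (r : S → S → Prop)
    (hrefl : ∀ a, r a a) (hsymm : ∀ a b, r a b → r b a)
    (n : ℕ) (hn : 1 ≤ n) (e : Quot (ChainRel r) ≃ Fin n) :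
    Nonempty ((MGroup S r 0 ⧸ (boundary r 0).range) ≃+ (Fin n → ℤ)) := by
  exact ⟨(zerothHomologyEquiv r hrefl hsymm).trans <|
    (FreeAbelianGroup.equivFinsupp _).trans <|
    (Finsupp.domCongr e).trans (Finsupp.linearEquivFunOnFinite ℤ ℤ (Fin n)).toAddEquiv⟩
end

section
/- Let S be a type with a reflexive symmetric relation r and let A, B ⊆ S, with restricted relations. Inside M_p(S, r), identify M_p(A, r|_A), M_p(B, r|_B), and M_p(A ∩ B, r|_{A∩B}) with the subgroups generated by the r-simplices contained in A, in B, and in A ∩ B respectively. Then for every p: (i) M_p(A, r|_A) ∩ M_p(B, r|_B) = M_p(A ∩ B, r|_{A∩B}); and (ii) if every r-simplex of S is contained in A or contained in B, then M_p(S, r) = M_p(A, r|_A) + M_p(B, r|_B); consequently, under the hypothesis of (ii), the inclusion (A, A ∩ B) ↪ (S, B) induces an isomorphism of quotient chain complexes M_•(A, r|_A)/M_•(A ∩ B, r|_{A∩B}) ≅ M_•(S, r)/M_•(B, r|_B). -/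
/-- The subgroup of `M_p(S, r)` generated by the `r`-simplices all of whose vertices
lie in `A`; it is identified with `M_p(A, r|_A)`. -/
def simplexSub {S : Type*} (r : S → S → Prop) (A : Set S) (p : ℕ) :
    AddSubgroup (MGroup S r p) :=
  AddSubgroup.closure
    {x | ∃ σ : {σ : Fin (p + 1) → S // IsSimplex r σ},
      (∀ i, σ.1 i ∈ A) ∧ x = FreeAbelianGroup.of σ}

/-- The projection of `M_p(S, r)` onto `M_p(A, r|_A)` that kills every simplex not contained
in `A`. -/
noncomputable def simplexProj {S : Type*} (r : S → S → Prop) (A : Set S) (p : ℕ) :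
    MGroup S r p →+ MGroup S r p :=
  open Classical in
  FreeAbelianGroup.lift fun σ => if ∀ i, σ.1 i ∈ A then FreeAbelianGroup.of σ else 0

theorem of_mem_simplexSub {S : Type*} {r : S → S → Prop} {A : Set S} {p : ℕ}
    {σ : {σ : Fin (p + 1) → S // IsSimplex r σ}} (hσ : ∀ i, σ.1 i ∈ A) :
    FreeAbelianGroup.of σ ∈ simplexSub r A p :=
  AddSubgroup.subset_closure ⟨σ, hσ, rfl⟩

theorem simplexSub_mono {S : Type*} (r : S → S → Prop) {A B : Set S} (h : A ⊆ B) (p : ℕ) :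
    simplexSub r A p ≤ simplexSub r B p := by
  refine (AddSubgroup.closure_le _).2 ?_
  rintro _ ⟨σ, hσ, rfl⟩
  exact of_mem_simplexSub fun i => h (hσ i)

theorem simplexProj_eq_self {S : Type*} {r : S → S → Prop} {A : Set S} {p : ℕ}
    {x : MGroup S r p} (hx : x ∈ simplexSub r A p) : simplexProj r A p x = x := by
  suffices h : simplexSub r A p ≤ (simplexProj r A p).eqLocus (AddMonoidHom.id _) from h hx
  refine (AddSubgroup.closure_le _).2 ?_
  rintro _ ⟨σ, hσ, rfl⟩
  change simplexProj r A p (FreeAbelianGroup.of σ) = FreeAbelianGroup.of σ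
  rw [simplexProj, FreeAbelianGroup.lift_apply_of, if_pos hσ]

theorem simplexProj_mem_inter {S : Type*} {r : S → S → Prop} {A : Set S} (B : Set S) {p : ℕ}
    {x : MGroup S r p} (hx : x ∈ simplexSub r A p) :
    simplexProj r B p x ∈ simplexSub r (A ∩ B) p := by
  suffices h : simplexSub r A p ≤ (simplexSub r (A ∩ B) p).comap (simplexProj r B p) from h hx
  refine (AddSubgroup.closure_le _).2 ?_
  rintro _ ⟨σ, hσ, rfl⟩
  change simplexProj r B p (FreeAbelianGroup.of σ) ∈ simplexSub r (A ∩ B) p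
  rw [simplexProj, FreeAbelianGroup.lift_apply_of]
  split_ifs with h
  · exact of_mem_simplexSub fun i => ⟨hσ i, h i⟩
  · exact zero_mem _

theorem simplexSub_inf {S : Type*} (r : S → S → Prop) (A B : Set S) (p : ℕ) :
    simplexSub r A p ⊓ simplexSub r B p = simplexSub r (A ∩ B) p := by
  refine le_antisymm ?_ (le_inf (simplexSub_mono r Set.inter_subset_left p)
    (simplexSub_mono r Set.inter_subset_right p))
  rintro x ⟨hA, hB⟩
  simpa only [simplexProj_eq_self hB] using simplexProj_mem_inter B hA

theorem simplexSub_sup_eq_top {S : Type*} {r : S → S → Prop} {A B : Set S} {p : ℕ}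
    (h : ∀ σ : {σ : Fin (p + 1) → S // IsSimplex r σ},
      (∀ i, σ.1 i ∈ A) ∨ (∀ i, σ.1 i ∈ B)) :
    simplexSub r A p ⊔ simplexSub r B p = ⊤ := by
  refine (AddSubgroup.eq_top_iff' _).2 fun x => ?_
  induction x using FreeAbelianGroup.induction_on with
  | zero => exact zero_mem _
  | of σ =>
    exact (h σ).elim (fun hA => AddSubgroup.mem_sup_left (of_mem_simplexSub hA))
      fun hB => AddSubgroup.mem_sup_right (of_mem_simplexSub hB)
  | neg σ hσ => exact neg_mem hσ
  | add x y hx hy => exact add_mem hx hy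

/-- If `H ⊓ K = L` and `H ⊔ K = ⊤`, then the inclusion of `H` induces an isomorphism
`H / L ≅ G / K`. -/
theorem exists_bijective_quotient_of_inf_of_sup_eq_top {G : Type*} [AddCommGroup G]
    {H K L : AddSubgroup G} (hinf : H ⊓ K = L) (hsup : H ⊔ K = ⊤) :
    ∃ θ : (H ⧸ L.addSubgroupOf H) →+ (G ⧸ K),
      (∀ x : H, θ (QuotientAddGroup.mk x) = QuotientAddGroup.mk x.val) ∧
        Function.Bijective θ := by
  have hle : L ≤ K := hinf ▸ inf_le_right
  refine ⟨QuotientAddGroup.lift (L.addSubgroupOf H) ((QuotientAddGroup.mk' K).comp H.subtype)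
    fun x hx => (QuotientAddGroup.eq_zero_iff _).2 (hle hx), fun x => rfl, ?_, ?_⟩
  · refine (injective_iff_map_eq_zero _).2 fun y => ?_
    obtain ⟨x, rfl⟩ := QuotientAddGroup.mk_surjective y
    intro hx
    have hxK : x.val ∈ K := (QuotientAddGroup.eq_zero_iff _).1 hx
    refine (QuotientAddGroup.eq_zero_iff _).2 (AddSubgroup.mem_addSubgroupOf.2 ?_)
    rw [← hinf]
    exact ⟨x.2, hxK⟩
  · intro y
    obtain ⟨g, rfl⟩ := QuotientAddGroup.mk_surjective y
    obtain ⟨a, ha, b, hb, rfl⟩ := AddSubgroup.mem_sup.1 (hsup ▸ AddSubgroup.mem_top g)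
    refine ⟨QuotientAddGroup.mk ⟨a, ha⟩, QuotientAddGroup.eq.2 ?_⟩
    simpa using hb

/-- Excision at the chain level: inside `M_p(S, r)`,
(i) `M_p(A) ∩ M_p(B) = M_p(A ∩ B)`; and (ii) if every `r`-simplex of `S` is
contained in `A` or in `B`, then `M_p(S) = M_p(A) + M_p(B)`, and consequently the
inclusion induces an isomorphism `M_p(A)/M_p(A ∩ B) ≅ M_p(S)/M_p(B)` in every
degree. -/
theorem chain_excision {S : Type*} (r : S → S → Prop)
    (hrefl : ∀ a, r a a) (hsymm : ∀ a b, r a b → r b a) (A B : Set S) :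
    (∀ p : ℕ, simplexSub r A p ⊓ simplexSub r B p = simplexSub r (A ∩ B) p) ∧
      ((∀ {p : ℕ} (σ : {σ : Fin (p + 1) → S // IsSimplex r σ}),
          (∀ i, σ.1 i ∈ A) ∨ (∀ i, σ.1 i ∈ B)) →
        (∀ p : ℕ, simplexSub r A p ⊔ simplexSub r B p = ⊤) ∧
          ∀ p : ℕ, ∃ θ : (simplexSub r A p ⧸
                ((simplexSub r (A ∩ B) p).addSubgroupOf (simplexSub r A p))) →+
              (MGroup S r p ⧸ simplexSub r B p),
            (∀ x : simplexSub r A p,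
              θ (QuotientAddGroup.mk x) = QuotientAddGroup.mk x.val) ∧
            Function.Bijective θ) := by
  exact ⟨simplexSub_inf r A B, fun h => ⟨fun _ => simplexSub_sup_eq_top h, fun p =>
    exists_bijective_quotient_of_inf_of_sup_eq_top (simplexSub_inf r A B p)
      (simplexSub_sup_eq_top h)⟩⟩
end
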